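/- For every natural number n and every p ∈ [0,1], T_{n+1}(p) ≤ 2·T_n(p)^2 − T_n(p)^4. -/

import Mathlib

open Set Filter Topology

noncomputable section

/-- The dyadic tile `[a/2^i, (a+1)/2^i] × [b/2^j, (b+1)/2^j]` as a subset of `ℝ × ℝ`. -/
def dyadicTile (i j a b : ℕ) : Set (ℝ × ℝ) :=
  Set.Icc ((a : ℝ) / 2 ^ i) (((a : ℝ) + 1) / 2 ^ i) ×ˢ
    Set.Icc ((b : ℝ) / 2 ^ j) (((b : ℝ) + 1) / 2 ^ j)

/-- `t` is a dyadic tile of order `n` contained in the unit square. -/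
def IsDyadicTile (n : ℕ) (t : Set (ℝ × ℝ)) : Prop :=
  ∃ i j a b : ℕ, i + j = n ∧ a < 2 ^ i ∧ b < 2 ^ j ∧ t = dyadicTile i j a b

/-- `F` is a tiling of the region `R` by dyadic tiles of order `n`:
a set of order-`n` tiles whose union is `R` and whose interiors are pairwise disjoint. -/
def IsTiling (n : ℕ) (F : Set (Set (ℝ × ℝ))) (R : Set (ℝ × ℝ)) : Prop :=
  (∀ t ∈ F, IsDyadicTile n t) ∧ ⋃₀ F = R ∧
    F.Pairwise fun s t => interior s ∩ interior t = ∅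

def unitSquare : Set (ℝ × ℝ) := Set.Icc (0 : ℝ) 1 ×ˢ Set.Icc (0 : ℝ) 1

/-- Index type for the dyadic tiles of order `n`: a shape `i` (width `2^{-i}`, height
`2^{-(n-i)}`) together with the horizontal and vertical positions. -/
abbrev TileIndex (n : ℕ) : Type :=
  Σ i : Fin (n + 1), Fin (2 ^ (i : ℕ)) × Fin (2 ^ (n - (i : ℕ)))

/-- The order-`n` tile corresponding to an index. -/
def tileOf (n : ℕ) (x : TileIndex n) : Set (ℝ × ℝ) :=
  dyadicTile (x.1 : ℕ) (n - (x.1 : ℕ)) (x.2.1 : ℕ) (x.2.2 : ℕ)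

/-- The set `S` of available order-`n` tiles admits a tiling of the unit square. -/
def TileableSquare (n : ℕ) (S : Finset (TileIndex n)) : Prop :=
  ∃ F : Set (Set (ℝ × ℝ)), (∀ t ∈ F, ∃ x ∈ S, t = tileOf n x) ∧ IsTiling n F unitSquare

open Classical in
/-- Probability of the event `E` when each of the `(n+1)·2^n` order-`n` dyadic tiles is
available independently with probability `p`. -/
def Pr (n : ℕ) (p : ℝ) (E : Finset (TileIndex n) → Prop) : ℝ :=
  ∑ S : Finset (TileIndex n),
    if E S then p ^ S.card * (1 - p) ^ ((n + 1) * 2 ^ n - S.card) else 0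

/-- `T n p`: the probability that some set of available order-`n` tiles tiles `[0,1]²`. -/
def T (n : ℕ) (p : ℝ) : ℝ := Pr n p (TileableSquare n)

/-- The critical probability `p_c`. -/
def pc : ℝ :=
  sInf {p : ℝ | p ∈ Set.Icc (0 : ℝ) 1 ∧ Tendsto (fun n => T n p) atTop (𝓝 1)}

/-! ### Product Bernoulli weights on finite sets -/

section Bernoulli

variable {α β : Type*} [Fintype α]

/-- The probability of the outcome `S` when each point of `α` is selected independently with
probability `p`. -/
def bernoulliWeight (p : ℝ) (S : Finset α) : ℝ :=
  p ^ S.card * (1 - p) ^ (Fintype.card α - S.card)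

open Classical in
/-- The real number `1` if `P` holds and `0` otherwise. -/
def propIndicator (P : Prop) : ℝ := if P then 1 else 0

lemma propIndicator_nonneg (P : Prop) : 0 ≤ propIndicator P := by
  unfold propIndicator
  split_ifs <;> simp

lemma propIndicator_mono {P Q : Prop} (h : P → Q) : propIndicator P ≤ propIndicator Q := by
  unfold propIndicator
  split_ifs <;> simp_all

lemma propIndicator_and (P Q : Prop) :
    propIndicator (P ∧ Q) = propIndicator P * propIndicator Q := by
  by_cases hP : P <;> by_cases hQ : Q <;> simp [propIndicator, hP, hQ]

lemma propIndicator_or (P Q : Prop) :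
    propIndicator (P ∨ Q) = propIndicator P + propIndicator Q - propIndicator (P ∧ Q) := by
  by_cases hP : P <;> by_cases hQ : Q <;> simp [propIndicator, hP, hQ]

/-- The probability of the event `E` when each point of `α` is selected independently with
probability `p`. -/
def bernoulliProb (p : ℝ) (E : Finset α → Prop) : ℝ :=
  ∑ S, bernoulliWeight p S * propIndicator (E S)

open Classical in
/-- The set of points mapped by `g` into `S`. -/
def pullback (g : α → β) (S : Finset β) : Finset α :=
  Finset.univ.filter fun x => g x ∈ S

lemma mem_pullback {g : α → β} {S : Finset β} {x : α} : x ∈ pullback g S ↔ g x ∈ S := by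
  simp [pullback]

lemma pullback_mono (g : α → β) : Monotone (pullback g) := fun _ _ h _ hx =>
  mem_pullback.2 (h (mem_pullback.1 hx))

lemma bernoulliWeight_nonneg {p : ℝ} (hp : p ∈ Set.Icc (0 : ℝ) 1) (S : Finset α) :
    0 ≤ bernoulliWeight p S :=
  mul_nonneg (pow_nonneg hp.1 _) (pow_nonneg (sub_nonneg.2 hp.2) _)

lemma sum_bernoulliWeight (p : ℝ) : ∑ S : Finset α, bernoulliWeight p S = 1 := by
  simpa [bernoulliWeight] using Fintype.sum_pow_mul_eq_add_pow α p (1 - p)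

lemma pullback_inl_disjSum (A : Finset α) (B : Finset β) :
    pullback Sum.inl (A.disjSum B) = A := by
  ext x
  simp [mem_pullback]

lemma pullback_inr_disjSum (A : Finset β) (B : Finset α) :
    pullback Sum.inr (A.disjSum B) = B := by
  ext x
  simp [mem_pullback]

variable [Fintype β]

lemma bernoulliWeight_disjSum (p : ℝ) (A : Finset α) (B : Finset β) :
    bernoulliWeight p (A.disjSum B) = bernoulliWeight p A * bernoulliWeight p B := by
  have hA := A.card_le_univ
  have hB := B.card_le_univ
  have h : Fintype.card α + Fintype.card β - (A.card + B.card)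
      = (Fintype.card α - A.card) + (Fintype.card β - B.card) := by omega
  simp only [bernoulliWeight, Finset.card_disjSum, Fintype.card_sum, h, pow_add]
  ring

lemma sum_bernoulliWeight_mul_sum (p : ℝ) (f : Finset (α ⊕ β) → ℝ) :
    ∑ S, bernoulliWeight p S * f S =
      ∑ A : Finset α, ∑ B : Finset β,
        bernoulliWeight p A * bernoulliWeight p B * f (A.disjSum B) := by
  rw [← Finset.sumEquiv.symm.toEquiv.sum_comp, Fintype.sum_prod_type]
  simp [bernoulliWeight_disjSum]

lemma pullback_pullback {γ : Type*} (f : α → β) (g : β → γ) (S : Finset γ) :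
    pullback f (pullback g S) = pullback (g ∘ f) S := by
  ext x
  simp [mem_pullback]

lemma bernoulliProb_equiv (p : ℝ) (e : α ≃ β) (E : Finset α → Prop) :
    bernoulliProb p (fun S => E (pullback e S)) = bernoulliProb p E := by
  unfold bernoulliProb
  rw [← e.finsetCongr.sum_comp]
  refine Finset.sum_congr rfl fun S _ => ?_
  have h : pullback e (e.finsetCongr S) = S := by
    ext x
    simp [mem_pullback]
  simp only [h]
  simp [bernoulliWeight, Fintype.card_congr e]

lemma bernoulliProb_inl (p : ℝ) (E : Finset α → Prop) :
    bernoulliProb p (fun S : Finset (α ⊕ β) => E (pullback Sum.inl S)) = bernoulliProb p E := by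
  simp only [bernoulliProb, sum_bernoulliWeight_mul_sum, pullback_inl_disjSum]
  refine Finset.sum_congr rfl fun A _ => ?_
  rw [← Finset.sum_mul, ← Finset.mul_sum, sum_bernoulliWeight, mul_one]

lemma bernoulliProb_injective (p : ℝ) {g : α → β} (hg : Function.Injective g)
    (E : Finset α → Prop) :
    bernoulliProb p (fun S => E (pullback g S)) = bernoulliProb p E := by
  classical
  let e : α ⊕ ↥(Set.range g)ᶜ ≃ β :=
    (Equiv.sumCongr (Equiv.ofInjective g hg) (Equiv.refl _)).trans (Equiv.Set.sumCompl _)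
  rw [← bernoulliProb_inl (β := ↥(Set.range g)ᶜ) p E, ← bernoulliProb_equiv p e]
  congr! 3 with S
  ext x
  simp [mem_pullback, e]

/-- Events depending on disjoint sets of coordinates are independent. -/
lemma bernoulliProb_and {γ : Type*} [Fintype γ] (p : ℝ) {g : α → γ} {h : β → γ}
    (hg : Function.Injective g) (hh : Function.Injective h) (hgh : ∀ x y, g x ≠ h y)
    (E : Finset α → Prop) (G : Finset β → Prop) :
    bernoulliProb p (fun S => E (pullback g S) ∧ G (pullback h S)) =
      bernoulliProb p E * bernoulliProb p G := by
  have hinj : Function.Injective (Sum.elim g h) := hg.sumElim hh hgh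
  rw [show (fun S => E (pullback g S) ∧ G (pullback h S)) = fun S =>
      (fun U : Finset (α ⊕ β) => E (pullback Sum.inl U) ∧ G (pullback Sum.inr U))
        (pullback (Sum.elim g h) S) from ?_, bernoulliProb_injective p hinj
      fun U : Finset (α ⊕ β) => E (pullback Sum.inl U) ∧ G (pullback Sum.inr U)]
  · simp only [bernoulliProb, sum_bernoulliWeight_mul_sum, pullback_inl_disjSum,
      pullback_inr_disjSum, Finset.sum_mul_sum, propIndicator_and, mul_mul_mul_comm]
  · simp only [pullback_pullback, Sum.elim_comp_inl, Sum.elim_comp_inr]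

lemma bernoulliProb_mono {p : ℝ} (hp : p ∈ Set.Icc (0 : ℝ) 1) {E G : Finset α → Prop}
    (h : ∀ S, E S → G S) : bernoulliProb p E ≤ bernoulliProb p G :=
  Finset.sum_le_sum fun S _ =>
    mul_le_mul_of_nonneg_left (propIndicator_mono (h S)) (bernoulliWeight_nonneg hp S)

lemma bernoulliProb_or (p : ℝ) (E G : Finset α → Prop) :
    bernoulliProb p (fun S => E S ∨ G S) =
      bernoulliProb p E + bernoulliProb p G - bernoulliProb p (fun S => E S ∧ G S) := by
  simp only [bernoulliProb, ← Finset.sum_add_distrib, ← Finset.sum_sub_distrib, ← mul_add,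
    ← mul_sub, ← propIndicator_or]

/-- The Harris inequality: increasing events are positively correlated. -/
lemma bernoulliProb_mul_le {p : ℝ} (hp : p ∈ Set.Icc (0 : ℝ) 1) {E G : Finset α → Prop}
    (hE : Monotone E) (hG : Monotone G) :
    bernoulliProb p E * bernoulliProb p G ≤ bernoulliProb p (fun S => E S ∧ G S) := by
  classical
  have key := fkg (μ := bernoulliWeight (α := α) p) (f := fun S => propIndicator (E S))
    (g := fun S => propIndicator (G S)) (fun S => bernoulliWeight_nonneg hp S)
    (fun S => propIndicator_nonneg _) (fun S => propIndicator_nonneg _)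
    (fun A B hAB => propIndicator_mono (hE hAB)) (fun A B hAB => propIndicator_mono (hG hAB))
    (fun A B => by
      have h1 := Finset.card_inter_add_card_union A B
      have hA := A.card_le_univ
      have hB := B.card_le_univ
      have hI := (A ∩ B).card_le_univ
      have hU := (A ∪ B).card_le_univ
      simp only [bernoulliWeight, Finset.inf_eq_inter, Finset.sup_eq_union]
      rw [mul_mul_mul_comm, mul_mul_mul_comm (p ^ (A ∩ B).card), ← pow_add, ← pow_add,
        ← pow_add, ← pow_add, h1]
      exact le_of_eq (by congr 2; omega))
  rw [sum_bernoulliWeight, one_mul] at key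
  simpa only [bernoulliProb, propIndicator_and] using key

end Bernoulli

lemma card_tileIndex (n : ℕ) : Fintype.card (TileIndex n) = (n + 1) * 2 ^ n := by
  have h (i : Fin (n + 1)) : 2 ^ (i : ℕ) * 2 ^ (n - (i : ℕ)) = 2 ^ n := by
    rw [← pow_add, Nat.add_sub_cancel' (Nat.le_of_lt_succ i.2)]
  simp [TileIndex, h]

lemma T_eq_bernoulliProb (n : ℕ) (p : ℝ) : T n p = bernoulliProb p (TileableSquare n) := by
  simp only [T, Pr, bernoulliProb, propIndicator, bernoulliWeight, card_tileIndex, mul_ite,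
    mul_one, mul_zero]

/-! ### Halving the unit square -/

/-- The dyadic interval `[a/2^k, (a+1)/2^k]`. -/
def dyadicIcc (k a : ℕ) : Set ℝ := Set.Icc ((a : ℝ) / 2 ^ k) (((a : ℝ) + 1) / 2 ^ k)

lemma mem_tileOf {n : ℕ} {x : TileIndex n} {q : ℝ × ℝ} :
    q ∈ tileOf n x ↔ q.1 ∈ dyadicIcc x.1 x.2.1 ∧ q.2 ∈ dyadicIcc (n - x.1) x.2.2 :=
  Iff.rfl

lemma mem_dyadicIcc {k a : ℕ} {u : ℝ} :
    u ∈ dyadicIcc k a ↔ (a : ℝ) ≤ u * 2 ^ k ∧ u * 2 ^ k ≤ a + 1 := by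
  have h : (0 : ℝ) < 2 ^ k := by positivity
  rw [dyadicIcc, Set.mem_Icc, div_le_iff₀ h, le_div_iff₀ h]

lemma dyadicIcc_subset {k a : ℕ} (ha : a < 2 ^ k) : dyadicIcc k a ⊆ Set.Icc 0 1 := by
  intro u hu
  have h : (0 : ℝ) < 2 ^ k := by positivity
  have ha' : (a : ℝ) + 1 ≤ 2 ^ k := by exact_mod_cast ha
  have ha0 : (0 : ℝ) ≤ a := by positivity
  rw [mem_dyadicIcc] at hu
  exact ⟨nonneg_of_mul_nonneg_left (ha0.trans hu.1) h,
    le_of_mul_le_mul_right (by linarith [hu.2]) h⟩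

lemma half_mem_dyadicIcc (s : Fin 2) {k a : ℕ} {u : ℝ} :
    1 / 2 * u + s / 2 ∈ dyadicIcc (k + 1) (a + s * 2 ^ k) ↔ u ∈ dyadicIcc k a := by
  rw [mem_dyadicIcc, mem_dyadicIcc]
  have h : (1 / 2 * u + (s : ℝ) / 2) * 2 ^ (k + 1) = u * 2 ^ k + s * 2 ^ k := by ring
  rw [h]
  push_cast
  constructor <;> rintro ⟨h1, h2⟩ <;> constructor <;> linarith

/-- Every point of `[0,1]` can be moved into `(0,1)` without entering a new dyadic interval of
order at most `n`. -/
lemma exists_interior_point (n : ℕ) {u : ℝ} (hu : u ∈ Set.Icc (0 : ℝ) 1) :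
    ∃ v ∈ Set.Ioo (0 : ℝ) 1, ∀ k ≤ n, ∀ a < 2 ^ k, v ∈ dyadicIcc k a → u ∈ dyadicIcc k a := by
  have hpow (k : ℕ) (hk : k ≤ n) :
      0 < (1 / 2 ^ (n + 1) : ℝ) * 2 ^ k ∧ (1 / 2 ^ (n + 1) : ℝ) * 2 ^ k < 1 := by
    refine ⟨by positivity, ?_⟩
    rw [one_div, inv_mul_lt_iff₀ (by positivity), mul_one]
    exact pow_lt_pow_right₀ (by norm_num) (by omega)
  have h0 := hpow 0 (Nat.zero_le n)
  rw [pow_zero, mul_one] at h0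
  obtain h | h := hu.1.eq_or_lt
  · refine ⟨1 / 2 ^ (n + 1), h0, fun k hk a _ hv => ?_⟩
    rw [mem_dyadicIcc] at hv ⊢
    have : a < 1 := by exact_mod_cast hv.1.trans_lt (hpow k hk).2
    obtain rfl : a = 0 := by omega
    simp [← h]
  obtain h' | h' := hu.2.eq_or_lt
  · refine ⟨1 - 1 / 2 ^ (n + 1), ⟨by linarith, by linarith⟩, fun k hk a ha hv => ?_⟩
    rw [mem_dyadicIcc] at hv ⊢
    have h2 := (hpow k hk).2
    have : 2 ^ k < a + 1 + 1 := by
      have : (2 ^ k : ℝ) < a + 1 + 1 := by linarith [hv.2]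
      exact_mod_cast this
    have h3 : ((2 ^ k : ℕ) : ℝ) = a + 1 := by
      rw [show 2 ^ k = a + 1 by omega]
      simp
    push_cast at h3
    rw [h', h3]
    constructor <;> linarith
  · exact ⟨u, ⟨h, h'⟩, fun _ _ _ _ hv => hv⟩

lemma exists_eq_add_of_half_mem (s : Fin 2) {k a : ℕ} {v : ℝ} (hv : v ∈ Set.Ioo (0 : ℝ) 1)
    (h : 1 / 2 * v + s / 2 ∈ dyadicIcc (k + 1) a) :
    ∃ a' < 2 ^ k, a = a' + s * 2 ^ k := by
  have hk : (0 : ℝ) < 2 ^ k := by positivity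
  have h1 : v * 2 ^ k < 2 ^ k := by nlinarith [hv.2]
  have h0 : 0 < v * 2 ^ k := mul_pos hv.1 hk
  have h2 : (1 / 2 * v + (s : ℝ) / 2) * 2 ^ (k + 1) = v * 2 ^ k + s * 2 ^ k := by ring
  rw [mem_dyadicIcc, h2] at h
  have hlt : a < 2 ^ k + s * 2 ^ k := by
    have : (a : ℝ) < 2 ^ k + s * 2 ^ k := by linarith [h.1]
    exact_mod_cast this
  have hge : s * 2 ^ k < a + 1 := by
    have : (s : ℝ) * 2 ^ k < a + 1 := by linarith [h.2]
    exact_mod_cast this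
  exact ⟨a - s * 2 ^ k, by omega, by omega⟩

lemma TileIndex.ext_val {n : ℕ} {x y : TileIndex n} (h1 : (x.1 : ℕ) = y.1)
    (h2 : (x.2.1 : ℕ) = y.2.1) (h3 : (x.2.2 : ℕ) = y.2.2) : x = y := by
  obtain ⟨i, a, b⟩ := x
  obtain ⟨j, c, d⟩ := y
  obtain rfl : i = j := Fin.ext h1
  obtain rfl : a = c := Fin.ext h2
  obtain rfl : b = d := Fin.ext h3
  rfl

lemma add_mul_pow_lt (s : Fin 2) {a k : ℕ} (ha : a < 2 ^ k) : a + s * 2 ^ k < 2 ^ (k + 1) := by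
  have : (s : ℕ) * 2 ^ k ≤ 1 * 2 ^ k := Nat.mul_le_mul_right _ (by omega)
  rw [pow_succ]
  omega

/-- The image of a tile in the left (`s = 0`) or right (`s = 1`) half of the unit square. -/
def verticalHalf (n : ℕ) (s : Fin 2) (x : TileIndex n) : TileIndex (n + 1) :=
  ⟨⟨x.1 + 1, Nat.succ_lt_succ x.1.2⟩, ⟨x.2.1 + s * 2 ^ (x.1 : ℕ), add_mul_pow_lt s x.2.1.2⟩,
    ⟨x.2.2, lt_of_lt_of_eq x.2.2.2 (by rw [Nat.add_sub_add_right])⟩⟩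

/-- The image of a tile in the bottom (`s = 0`) or top (`s = 1`) half of the unit square. -/
def horizontalHalf (n : ℕ) (s : Fin 2) (x : TileIndex n) : TileIndex (n + 1) :=
  ⟨⟨x.1, x.1.2.trans (Nat.lt_succ_self _)⟩, x.2.1,
    ⟨x.2.2 + s * 2 ^ (n - (x.1 : ℕ)), lt_of_lt_of_eq (add_mul_pow_lt s x.2.2.2)
      (by rw [Nat.sub_add_comm (Nat.le_of_lt_succ x.1.2)])⟩⟩

lemma verticalHalf_injective (n : ℕ) (s : Fin 2) : Function.Injective (verticalHalf n s) := by
  intro x y h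
  have h1 := congrArg (fun z => (z.1 : ℕ)) h
  have h2 := congrArg (fun z => (z.2.1 : ℕ)) h
  have h3 := congrArg (fun z => (z.2.2 : ℕ)) h
  simp only [verticalHalf] at h1 h2 h3
  have h4 : (x.1 : ℕ) = y.1 := by omega
  have h5 : (s : ℕ) * 2 ^ (x.1 : ℕ) = s * 2 ^ (y.1 : ℕ) := congrArg (fun k => (s : ℕ) * 2 ^ k) h4
  exact TileIndex.ext_val h4 (by omega) h3

lemma horizontalHalf_injective (n : ℕ) (s : Fin 2) :
    Function.Injective (horizontalHalf n s) := by
  intro x y h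
  have h1 := congrArg (fun z => (z.1 : ℕ)) h
  have h2 := congrArg (fun z => (z.2.1 : ℕ)) h
  have h3 := congrArg (fun z => (z.2.2 : ℕ)) h
  simp only [horizontalHalf] at h1 h2 h3
  have h4 : (s : ℕ) * 2 ^ (n - (x.1 : ℕ)) = s * 2 ^ (n - (y.1 : ℕ)) :=
    congrArg (fun k => (s : ℕ) * 2 ^ (n - k)) h1
  exact TileIndex.ext_val h1 h2 (by omega)

lemma verticalHalf_ne (n : ℕ) (x y : TileIndex n) : verticalHalf n 0 x ≠ verticalHalf n 1 y := by
  intro h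
  have h1 := congrArg (fun z => (z.1 : ℕ)) h
  have h2 := congrArg (fun z => (z.2.1 : ℕ)) h
  simp only [verticalHalf, Fin.val_zero, Fin.val_one] at h1 h2
  have h4 : (x.1 : ℕ) = y.1 := by omega
  have hx := x.2.1.2
  have h5 : 2 ^ (x.1 : ℕ) = 2 ^ (y.1 : ℕ) := congrArg (fun k => 2 ^ k) h4
  omega

lemma horizontalHalf_ne (n : ℕ) (x y : TileIndex n) :
    horizontalHalf n 0 x ≠ horizontalHalf n 1 y := by
  intro h
  have h1 := congrArg (fun z => (z.1 : ℕ)) h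
  have h2 := congrArg (fun z => (z.2.2 : ℕ)) h
  simp only [horizontalHalf, Fin.val_zero, Fin.val_one] at h1 h2
  have hx := x.2.2.2
  have h4 : 2 ^ (n - (x.1 : ℕ)) = 2 ^ (n - (y.1 : ℕ)) := congrArg (fun k => 2 ^ (n - k)) h1
  omega

lemma isDyadicTile_tileOf (n : ℕ) (x : TileIndex n) : IsDyadicTile n (tileOf n x) :=
  ⟨x.1, n - x.1, x.2.1, x.2.2, Nat.add_sub_cancel' (Nat.le_of_lt_succ x.1.2), x.2.1.2, x.2.2.2,
    rfl⟩

lemma tileOf_subset_unitSquare (n : ℕ) (x : TileIndex n) : tileOf n x ⊆ unitSquare :=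
  Set.prod_mono (dyadicIcc_subset x.2.1.2) (dyadicIcc_subset x.2.2.2)

lemma tileableSquare_mono (n : ℕ) : Monotone (TileableSquare n) := by
  rintro S U h ⟨F, hF, hT⟩
  refine ⟨F, fun t ht => ?_, hT⟩
  obtain ⟨x, hx, rfl⟩ := hF t ht
  exact ⟨x, h hx, rfl⟩

/-- Tilings pull back along a homeomorphism compatible with a map of tile indices. -/
lemma tileableSquare_pullback {m n : ℕ} (e : ℝ × ℝ ≃ₜ ℝ × ℝ) (g : TileIndex n → TileIndex m)
    (hg : ∀ x, e ⁻¹' tileOf m (g x) = tileOf n x) {S : Finset (TileIndex m)}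
    {F : Set (Set (ℝ × ℝ))} (hF : F.Pairwise fun s t => interior s ∩ interior t = ∅)
    (hcover : ∀ q ∈ unitSquare, ∃ x, g x ∈ S ∧ tileOf m (g x) ∈ F ∧ q ∈ tileOf n x) :
    TileableSquare n (pullback g S) := by
  refine ⟨{t | ∃ x, g x ∈ S ∧ tileOf m (g x) ∈ F ∧ t = tileOf n x}, ?_, ?_, ?_, ?_⟩
  · rintro t ⟨x, hx, -, rfl⟩
    exact ⟨x, mem_pullback.2 hx, rfl⟩
  · rintro t ⟨x, -, -, rfl⟩
    exact isDyadicTile_tileOf n x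
  · refine Set.Subset.antisymm (Set.sUnion_subset ?_) fun q hq => ?_
    · rintro t ⟨x, -, -, rfl⟩
      exact tileOf_subset_unitSquare n x
    · obtain ⟨x, hx, hxF, hqx⟩ := hcover q hq
      exact ⟨_, ⟨x, hx, hxF, rfl⟩, hqx⟩
  · rintro _ ⟨x, -, hx, rfl⟩ _ ⟨y, -, hy, rfl⟩ hxy
    have hne : tileOf m (g x) ≠ tileOf m (g y) := fun h => hxy (by rw [← hg x, ← hg y, h])
    rw [← hg x, ← hg y, ← e.preimage_interior, ← e.preimage_interior, ← Set.preimage_inter,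
      hF hx hy hne, Set.preimage_empty]

/-- The affine bijection from `ℝ` to itself carrying `[0,1]` to `[s/2,(s+1)/2]`. -/
def halfHomeomorph (s : Fin 2) : ℝ ≃ₜ ℝ :=
  affineHomeomorph (1 / 2) (s / 2) (by norm_num)

lemma halfHomeomorph_apply (s : Fin 2) (u : ℝ) : halfHomeomorph s u = 1 / 2 * u + s / 2 := rfl

lemma halfHomeomorph_mem_Icc (s : Fin 2) {u : ℝ} (hu : u ∈ Set.Icc (0 : ℝ) 1) :
    halfHomeomorph s u ∈ Set.Icc (0 : ℝ) 1 := by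
  have h0 : (0 : ℝ) ≤ s := by positivity
  have h1 : (s : ℝ) ≤ 1 := by exact_mod_cast Nat.le_of_lt_succ s.2
  rw [halfHomeomorph_apply]
  constructor <;> linarith [hu.1, hu.2]

lemma preimage_tileOf_verticalHalf (n : ℕ) (s : Fin 2) (x : TileIndex n) :
    (halfHomeomorph s).prodCongr (Homeomorph.refl ℝ) ⁻¹' tileOf (n + 1) (verticalHalf n s x) =
      tileOf n x := by
  ext q
  rw [Set.mem_preimage, mem_tileOf, mem_tileOf]
  refine and_congr (half_mem_dyadicIcc s) ?_
  simp [verticalHalf]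

lemma preimage_tileOf_horizontalHalf (n : ℕ) (s : Fin 2) (x : TileIndex n) :
    (Homeomorph.refl ℝ).prodCongr (halfHomeomorph s) ⁻¹' tileOf (n + 1) (horizontalHalf n s x) =
      tileOf n x := by
  ext q
  rw [Set.mem_preimage, mem_tileOf, mem_tileOf]
  refine and_congr Iff.rfl ?_
  rw [← half_mem_dyadicIcc s (a := x.2.2), ← Nat.sub_add_comm (Nat.le_of_lt_succ x.1.2)]
  rfl

lemma tileableSquare_verticalHalf {n : ℕ} {S : Finset (TileIndex (n + 1))}
    {F : Set (Set (ℝ × ℝ))} (hS : ∀ t ∈ F, ∃ x ∈ S, t = tileOf (n + 1) x)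
    (hF : IsTiling (n + 1) F unitSquare)
    (h : ∀ x, tileOf (n + 1) x ∈ F → (x.1 : ℕ) ≠ 0) (s : Fin 2) :
    TileableSquare n (pullback (verticalHalf n s) S) := by
  refine tileableSquare_pullback _ _ (preimage_tileOf_verticalHalf n s) hF.2.2 ?_
  rintro ⟨u, w⟩ ⟨hu, hw⟩
  obtain ⟨v, hv, hvu⟩ := exists_interior_point n hu
  have hmem : (halfHomeomorph s v, w) ∈ ⋃₀ F := by
    rw [hF.2.1]
    exact ⟨halfHomeomorph_mem_Icc s ⟨hv.1.le, hv.2.le⟩, hw⟩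
  obtain ⟨t, ht, hqt⟩ := hmem
  obtain ⟨x, hxS, rfl⟩ := hS t ht
  have hx0 := h x ht
  obtain ⟨⟨i, hi⟩, ⟨a, ha⟩, ⟨b, hb⟩⟩ := x
  obtain _ | k := i
  · exact absurd rfl hx0
  obtain ⟨a', ha', rfl⟩ := exists_eq_add_of_half_mem s hv hqt.1
  let x : TileIndex n := ⟨⟨k, Nat.lt_of_succ_lt_succ hi⟩, ⟨a', ha'⟩,
    ⟨b, lt_of_lt_of_eq hb (by simp)⟩⟩
  refine ⟨x, hxS, ht, ?_⟩
  have hvw : (v, w) ∈ tileOf n x := by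
    rw [← preimage_tileOf_verticalHalf n s x]
    exact hqt
  exact ⟨hvu k (by omega) a' ha' hvw.1, hvw.2⟩

lemma tileableSquare_horizontalHalf {n : ℕ} {S : Finset (TileIndex (n + 1))}
    {F : Set (Set (ℝ × ℝ))} (hS : ∀ t ∈ F, ∃ x ∈ S, t = tileOf (n + 1) x)
    (hF : IsTiling (n + 1) F unitSquare)
    (h : ∀ x, tileOf (n + 1) x ∈ F → (x.1 : ℕ) ≠ n + 1) (s : Fin 2) :
    TileableSquare n (pullback (horizontalHalf n s) S) := by
  refine tileableSquare_pullback _ _ (preimage_tileOf_horizontalHalf n s) hF.2.2 ?_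
  rintro ⟨w, u⟩ ⟨hw, hu⟩
  obtain ⟨v, hv, hvu⟩ := exists_interior_point n hu
  have hmem : (w, halfHomeomorph s v) ∈ ⋃₀ F := by
    rw [hF.2.1]
    exact ⟨hw, halfHomeomorph_mem_Icc s ⟨hv.1.le, hv.2.le⟩⟩
  obtain ⟨t, ht, hqt⟩ := hmem
  obtain ⟨x, hxS, rfl⟩ := hS t ht
  have hx0 := h x ht
  obtain ⟨⟨i, hi⟩, ⟨a, ha⟩, ⟨b, hb⟩⟩ := x
  have hin : i ≤ n := by
    dsimp only at hx0
    omega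
  have hsub : n + 1 - i = n - i + 1 := Nat.sub_add_comm hin
  have hq2 : halfHomeomorph s v ∈ dyadicIcc (n - i + 1) b := by
    rw [← hsub]
    exact hqt.2
  obtain ⟨b', hb', rfl⟩ := exists_eq_add_of_half_mem s hv hq2
  let x : TileIndex n := ⟨⟨i, Nat.lt_succ_of_le hin⟩, ⟨a, ha⟩, ⟨b', hb'⟩⟩
  refine ⟨x, hxS, ht, ?_⟩
  have hvw : (w, v) ∈ tileOf n x := by
    rw [← preimage_tileOf_horizontalHalf n s x]
    exact hqt
  exact ⟨hvw.1, hvu (n - i) (by omega) b' hb' hvw.2⟩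

lemma interior_tileOf (n : ℕ) (x : TileIndex n) :
    interior (tileOf n x) =
      Set.Ioo ((x.2.1 : ℝ) / 2 ^ (x.1 : ℕ)) (((x.2.1 : ℝ) + 1) / 2 ^ (x.1 : ℕ)) ×ˢ
        Set.Ioo ((x.2.2 : ℝ) / 2 ^ (n - x.1)) (((x.2.2 : ℝ) + 1) / 2 ^ (n - x.1)) := by
  rw [tileOf, dyadicTile, interior_prod_eq, interior_Icc, interior_Icc]

/-- A tile of full width and a tile of full height cannot belong to the same tiling. -/
lemma false_of_full_width_of_full_height {n : ℕ} {F : Set (Set (ℝ × ℝ))}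
    (hF : F.Pairwise fun s t => interior s ∩ interior t = ∅) {x y : TileIndex (n + 1)}
    (hx : tileOf (n + 1) x ∈ F) (hy : tileOf (n + 1) y ∈ F) (hx0 : (x.1 : ℕ) = 0)
    (hyn : (y.1 : ℕ) = n + 1) : False := by
  obtain ⟨⟨i, hi⟩, ⟨a, ha⟩, ⟨b, hb⟩⟩ := x
  obtain ⟨⟨j, hj⟩, ⟨c, hc⟩, ⟨d, hd⟩⟩ := y
  obtain rfl : i = 0 := hx0
  obtain rfl : j = n + 1 := hyn
  obtain rfl : a = 0 := by simpa using ha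
  obtain rfl : d = 0 := by simpa using hd
  have hpow : (0 : ℝ) < 2 ^ (n + 1) := by positivity
  have hb' : (b : ℝ) + 1 ≤ 2 ^ (n + 1) := by exact_mod_cast hb
  have hc' : (c : ℝ) + 1 ≤ 2 ^ (n + 1) := by exact_mod_cast hc
  have hb0 : (0 : ℝ) ≤ b := by positivity
  have hc0 : (0 : ℝ) ≤ c := by positivity
  by_cases heq : tileOf (n + 1) ⟨⟨0, hi⟩, ⟨0, ha⟩, ⟨b, hb⟩⟩ =
      tileOf (n + 1) ⟨⟨n + 1, hj⟩, ⟨c, hc⟩, ⟨0, hd⟩⟩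
  · have hmem (u : ℝ) (hu : u ∈ Set.Icc (0 : ℝ) 1) : u ∈ dyadicIcc (n + 1) c := by
      have : (u, (b : ℝ) / 2 ^ (n + 1)) ∈
          tileOf (n + 1) ⟨⟨0, hi⟩, ⟨0, ha⟩, ⟨b, hb⟩⟩ := by
        rw [mem_tileOf]
        refine ⟨by simpa [dyadicIcc] using hu, Set.left_mem_Icc.2 ?_⟩
        exact div_le_div_of_nonneg_right (by simp) (by positivity)
      rw [heq] at this
      exact this.1
    have h0 := (mem_dyadicIcc.1 (hmem 0 (by simp))).1
    have h1 := (mem_dyadicIcc.1 (hmem 1 (by simp))).2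
    have h2 : (1 : ℝ) < 2 ^ (n + 1) := one_lt_pow₀ (by norm_num) (by omega)
    linarith
  · have hmem : (((c : ℝ) + 1 / 2) / 2 ^ (n + 1), ((b : ℝ) + 1 / 2) / 2 ^ (n + 1)) ∈
        (∅ : Set (ℝ × ℝ)) := by
      rw [← hF hx hy heq, interior_tileOf, interior_tileOf]
      simp only [Set.mem_inter_iff, Set.mem_prod, Set.mem_Ioo, Nat.sub_self, Nat.sub_zero,
        pow_zero, div_one, Nat.cast_zero, zero_add]
      refine ⟨⟨⟨?_, ?_⟩, ?_, ?_⟩, ⟨?_, ?_⟩, ?_, ?_⟩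
      all_goals first
        | positivity
        | exact div_lt_div_of_pos_right (by linarith) hpow
        | (rw [div_lt_one hpow]; linarith)
    exact hmem

/-- If the unit square is tileable at order `n + 1`, then so are both its vertical halves or both
its horizontal halves. -/
lemma TileableSquare.halves {n : ℕ} {S : Finset (TileIndex (n + 1))}
    (h : TileableSquare (n + 1) S) :
    (TileableSquare n (pullback (verticalHalf n 0) S) ∧
        TileableSquare n (pullback (verticalHalf n 1) S)) ∨
      (TileableSquare n (pullback (horizontalHalf n 0) S) ∧
        TileableSquare n (pullback (horizontalHalf n 1) S)) := by
  obtain ⟨F, hS, hF⟩ := h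
  by_cases hx : ∀ x, tileOf (n + 1) x ∈ F → (x.1 : ℕ) ≠ 0
  · exact .inl ⟨tileableSquare_verticalHalf hS hF hx 0, tileableSquare_verticalHalf hS hF hx 1⟩
  · push Not at hx
    obtain ⟨x, hxF, hx0⟩ := hx
    have hy : ∀ y, tileOf (n + 1) y ∈ F → (y.1 : ℕ) ≠ n + 1 := fun y hyF hyn =>
      false_of_full_width_of_full_height hF.2.2 hxF hyF hx0 hyn
    exact .inr ⟨tileableSquare_horizontalHalf hS hF hy 0, tileableSquare_horizontalHalf hS hF hy 1⟩

lemma monotone_pullback_and_pullback {m n : ℕ} (g h : TileIndex n → TileIndex m) :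
    Monotone fun S => TileableSquare n (pullback g S) ∧ TileableSquare n (pullback h S) :=
  fun _ _ hS => And.imp (tileableSquare_mono n (pullback_mono g hS))
    (tileableSquare_mono n (pullback_mono h hS))

/-- `T_{n+1}(p) ≤ 2 T_n(p)² - T_n(p)⁴`. -/
theorem T_succ_le_fkg (n : ℕ) (p : ℝ) (hp : p ∈ Set.Icc (0 : ℝ) 1) :
    T (n + 1) p ≤ 2 * T n p ^ 2 - T n p ^ 4 := by
  have hV := bernoulliProb_and p (verticalHalf_injective n 0) (verticalHalf_injective n 1)
    (verticalHalf_ne n) (TileableSquare n) (TileableSquare n)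
  have hH := bernoulliProb_and p (horizontalHalf_injective n 0) (horizontalHalf_injective n 1)
    (horizontalHalf_ne n) (TileableSquare n) (TileableSquare n)
  have hle := bernoulliProb_mono hp fun S (hS : TileableSquare (n + 1) S) => hS.halves
  have hHarris := bernoulliProb_mul_le hp
    (monotone_pullback_and_pullback (verticalHalf n 0) (verticalHalf n 1))
    (monotone_pullback_and_pullback (horizontalHalf n 0) (horizontalHalf n 1))
  rw [bernoulliProb_or, hV, hH] at hle
  rw [hV, hH] at hHarris
  rw [T_eq_bernoulliProb, T_eq_bernoulliProb]
  linarith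

end
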